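/- Let G₁ and G₂ be discrete convergence groups acting on a compact metrizable space M, suppose J = G₁ ∩ G₂ is geometrically finite and a proper subgroup of both G₁ and G₂, suppose G₁ and G₂ are in AFP ping-pong position with respect to J with closed sets B₁, B₂, and let G = ⟨G₁, G₂⟩ act on M as a convergence group. If G₁ and G₂ are geometrically finite, then Λ(G) ∖ (Λ(G₁) ∪ Λ(G₂)) ⊆ T₁, where T₁ = ⋃_{g ∈ G₁ ∖ J} g B₁ ∪ ⋃_{g ∈ G₂ ∖ J} g B₂. -/

import Mathlib

open Filter Topology Set

namespace ConvergenceGroups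

variable {M : Type*} [TopologicalSpace M]

/-- The group of self-homeomorphisms of `M`, with `(g * h) x = g (h x)`. -/
instance : Group (M ≃ₜ M) where
  mul g h := h.trans g
  one := Homeomorph.refl M
  inv := Homeomorph.symm
  mul_assoc _ _ _ := rfl
  one_mul _ := Homeomorph.ext fun _ => rfl
  mul_one _ := Homeomorph.ext fun _ => rfl
  inv_mul_cancel g := Homeomorph.ext fun x => g.symm_apply_apply x

/-- The inclusion of the self-homeomorphisms of `M` into the continuous self-maps of `M`;
the latter carries the compact-open topology. -/
def toCM (g : M ≃ₜ M) : C(M, M) := ⟨⇑g, g.continuous⟩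

/-- `(g k)` is a convergence sequence with attracting point `zp` and repelling point `zm`:
the maps `g k` converge to the constant map `zp` uniformly on compact subsets of
`M ∖ {zm}`. -/
def IsConvSeq (g : ℕ → M ≃ₜ M) (zp zm : M) : Prop :=
  ∀ K : Set M, IsCompact K → zm ∉ K → ∀ U ∈ 𝓝 zp,
    ∀ᶠ k in atTop, ∀ x ∈ K, g k x ∈ U

/-- `(g k)` converges in the compact-open topology to a homeomorphism. -/
def TendstoHomeo (g : ℕ → M ≃ₜ M) : Prop :=
  ∃ h : M ≃ₜ M, Tendsto (fun k => toCM (g k)) atTop (𝓝 (toCM h))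

/-- `G` acts on `M` as a convergence group: every sequence of pairwise distinct elements of
`G` has a subsequence which either converges in the compact-open topology to a
homeomorphism, or is a convergence sequence. -/
def IsConvGroup (G : Subgroup (M ≃ₜ M)) : Prop :=
  ∀ g : ℕ → M ≃ₜ M, (∀ k, g k ∈ G) → Function.Injective g →
    ∃ φ : ℕ → ℕ, StrictMono φ ∧
      (TendstoHomeo (g ∘ φ) ∨ ∃ zp zm : M, IsConvSeq (g ∘ φ) zp zm)

/-- `G` acts on `M` as a discrete convergence group: every sequence of pairwise distinct
elements of `G` has a subsequence which is a convergence sequence. -/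
def IsDiscreteConvGroup (G : Subgroup (M ≃ₜ M)) : Prop :=
  ∀ g : ℕ → M ≃ₜ M, (∀ k, g k ∈ G) → Function.Injective g →
    ∃ φ : ℕ → ℕ, StrictMono φ ∧ ∃ zp zm : M, IsConvSeq (g ∘ φ) zp zm

/-- The limit set `Λ(G)`: the set of all attracting points of convergence sequences in `G`. -/
def limitSet (G : Subgroup (M ≃ₜ M)) : Set M :=
  {zp | ∃ g : ℕ → M ≃ₜ M, (∀ k, g k ∈ G) ∧ Function.Injective g ∧
    ∃ zm : M, IsConvSeq g zp zm}

/-- `x` is a conical limit point for `G`: there is a sequence of pairwise distinct elements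
`g k` of `G` such that for every `z ≠ x` the pairs `(g k x, g k z)` remain in a compact
subset of `(M × M) ∖ Δ`. -/
def IsConicalLimitPt (G : Subgroup (M ≃ₜ M)) (x : M) : Prop :=
  ∃ g : ℕ → M ≃ₜ M, (∀ k, g k ∈ G) ∧ Function.Injective g ∧
    ∀ z : M, z ≠ x → ∃ K : Set (M × M), IsCompact K ∧ (∀ p ∈ K, p.1 ≠ p.2) ∧
      ∀ k, (g k x, g k z) ∈ K

/-- `g` is elliptic: the closure of the cyclic group generated by `g` is compact in
`Homeo(M)` (viewed inside `C(M, M)` with the compact-open topology). -/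
def IsEllipticElem (g : M ≃ₜ M) : Prop :=
  IsCompact (closure (Set.range fun n : ℤ => toCM (g ^ n))) ∧
    closure (Set.range fun n : ℤ => toCM (g ^ n)) ⊆ Set.range (toCM (M := M))

/-- `g` is parabolic: not elliptic, and fixes exactly one point of `M`. -/
def IsParabolicElem (g : M ≃ₜ M) : Prop :=
  ¬IsEllipticElem g ∧ ∃! x : M, g x = x

/-- `g` is loxodromic: not elliptic, and fixes exactly two points of `M`. -/
def IsLoxodromicElem (g : M ≃ₜ M) : Prop :=
  ¬IsEllipticElem g ∧ ∃ a b : M, a ≠ b ∧ {x : M | g x = x} = {a, b}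

/-- `p` is a parabolic point for `G`: it is the fixed point of a parabolic element of `G`. -/
def IsParabolicPt (G : Subgroup (M ≃ₜ M)) (p : M) : Prop :=
  ∃ g ∈ G, IsParabolicElem g ∧ g p = p

/-- `p` is a bounded parabolic point for `G`: it is a parabolic point and the quotient of
`Λ(G) ∖ {p}` by the stabilizer of `p` in `G` is compact. -/
def IsBoundedParabolicPt (G : Subgroup (M ≃ₜ M)) (p : M) : Prop :=
  IsParabolicPt G p ∧
    ∃ K : Set M, IsCompact K ∧ K ⊆ limitSet G \ {p} ∧
      ∀ x ∈ limitSet G \ {p}, ∃ h ∈ G, h p = p ∧ h x ∈ K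

/-- `G` is geometrically finite: every point of `Λ(G)` is a conical limit point or a
bounded parabolic point. -/
def IsGeomFinite (G : Subgroup (M ≃ₜ M)) : Prop :=
  ∀ x ∈ limitSet G, IsConicalLimitPt G x ∨ IsBoundedParabolicPt G x

/-- `J` is a fully quasi-convex subgroup of `G`: `J ≤ G`, `J` acts geometrically finitely,
and `g Λ(J) ∩ Λ(J) = ∅` for all but finitely many left cosets `gJ`. -/
def IsFullyQuasiconvex (G J : Subgroup (M ≃ₜ M)) : Prop :=
  J ≤ G ∧ IsGeomFinite J ∧
    ∃ F : Set (M ≃ₜ M), F.Finite ∧ ∀ g ∈ G,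
      (⇑g '' limitSet J ∩ limitSet J).Nonempty → ∃ f ∈ F, ∃ j ∈ J, g = f * j

/-- `G₁` and `G₂` are in AFP ping-pong position with respect to `J = G₁ ∩ G₂`, witnessed by
the closed sets `B₁`, `B₂`. -/
structure AFPPingPong (G₁ G₂ J : Subgroup (M ≃ₜ M)) (B₁ B₂ : Set M) : Prop where
  isClosed₁ : IsClosed B₁
  isClosed₂ : IsClosed B₂
  int_nonempty₁ : (interior B₁).Nonempty
  int_nonempty₂ : (interior B₂).Nonempty
  int_disjoint : interior B₁ ∩ interior B₂ = ∅
  inv₁ : ∀ j ∈ J, ⇑j '' B₁ = B₁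
  inv₂ : ∀ j ∈ J, ⇑j '' B₂ = B₂
  pp₁ : ∀ g ∈ G₁, g ∉ J → ⇑g '' B₁ ⊆ interior B₂
  pp₂ : ∀ g ∈ G₂, g ∉ J → ⇑g '' B₂ ⊆ interior B₁
  lim₁ : limitSet G₁ \ limitSet J ⊆ interior B₂
  lim₂ : limitSet G₂ \ limitSet J ⊆ interior B₁

/-- `G₀` is in HNN ping-pong position with respect to `f`, `J₁`, `J₋₁`, witnessed by the
closed sets `B₁`, `Bm` (where `Bm` plays the role of `B₋₁`). -/
structure HNNPingPong (G₀ J₁ Jm : Subgroup (M ≃ₜ M)) (f : M ≃ₜ M) (B₁ Bm : Set M) :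
    Prop where
  isClosed₁ : IsClosed B₁
  isClosedm : IsClosed Bm
  int_nonempty₁ : (interior B₁).Nonempty
  int_nonemptym : (interior Bm).Nonempty
  int_disjoint : interior B₁ ∩ interior Bm = ∅
  inv₁ : ∀ j ∈ J₁, ⇑j '' B₁ = B₁
  invm : ∀ j ∈ Jm, ⇑j '' Bm = Bm
  prec₁ : ∀ g ∈ G₀, g ∉ J₁ → ⇑g '' B₁ ∩ B₁ = ∅
  precm : ∀ g ∈ G₀, g ∉ Jm → ⇑g '' Bm ∩ Bm = ∅
  cross : ∀ g ∈ G₀, ⇑g '' B₁ ∩ Bm = ∅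
  mapf : ⇑f '' ((B₁ ∪ Bm)ᶜ ∪ B₁) = interior B₁
  lim₁ : limitSet G₀ ∩ B₁ = limitSet J₁
  limm : limitSet G₀ ∩ Bm = limitSet Jm
  proper : (⋃ g ∈ G₀, ⇑g '' (B₁ ∪ Bm))ᶜ.Nonempty

/-- A letter of type `i` (`i = 0` for `G₁`, `i = 1` for `G₂`) for amalgamated free product
normal forms: an element of `G_{i+1} ∖ J`. -/
def AFPLetter (G₁ G₂ J : Subgroup (M ≃ₜ M)) (i : Fin 2) (g : M ≃ₜ M) : Prop :=
  g ∈ (if i = 0 then G₁ else G₂) ∧ g ∉ J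

/-- `h` is an `(i,j)`-form: a product of a nonempty alternating list of letters, whose first
letter lies in `G_i ∖ J` and whose last letter lies in `G_j ∖ J` (indices shifted so that
`0` stands for `G₁` and `1` for `G₂`). -/
def IsIJForm (G₁ G₂ J : Subgroup (M ≃ₜ M)) (i j : Fin 2) (h : M ≃ₜ M) : Prop :=
  ∃ l : List (M ≃ₜ M), l ≠ [] ∧ l.prod = h ∧
    (∀ g ∈ l, AFPLetter G₁ G₂ J 0 g ∨ AFPLetter G₁ G₂ J 1 g) ∧
    l.Chain' (fun a b => ∀ c : Fin 2, AFPLetter G₁ G₂ J c a → AFPLetter G₁ G₂ J (1 - c) b) ∧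
    (∀ hne : l ≠ [], AFPLetter G₁ G₂ J i (l.head hne)) ∧
    (∀ hne : l ≠ [], AFPLetter G₁ G₂ J j (l.getLast hne))

section Basic

theorem homeo_mul_apply (g h : M ≃ₜ M) (x : M) : (g * h) x = g (h x) := rfl

theorem homeo_inv_apply_self (g : M ≃ₜ M) (x : M) : g⁻¹ (g x) = x :=
  g.symm_apply_apply x

theorem homeo_apply_inv_self (g : M ≃ₜ M) (x : M) : g (g⁻¹ x) = x :=
  g.apply_symm_apply x

theorem IsDiscreteConvGroup.mono {G J : Subgroup (M ≃ₜ M)} (hG : IsDiscreteConvGroup G)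
    (h : J ≤ G) : IsDiscreteConvGroup J :=
  fun g hg hinj => hG g (fun k => h (hg k)) hinj

theorem limitSet_mono {G J : Subgroup (M ≃ₜ M)} (h : J ≤ G) : limitSet J ⊆ limitSet G :=
  fun _ ⟨g, hg, hinj, hz⟩ => ⟨g, fun k => h (hg k), hinj, hz⟩

theorem IsConvSeq.comp {g : ℕ → M ≃ₜ M} {zp zm : M} (hg : IsConvSeq g zp zm) {φ : ℕ → ℕ}
    (hφ : Tendsto φ atTop atTop) : IsConvSeq (g ∘ φ) zp zm :=
  fun K hK hzm U hU => hφ.eventually (hg K hK hzm U hU)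

theorem IsConvSeq.mem_limitSet {G : Subgroup (M ≃ₜ M)} {g : ℕ → M ≃ₜ M} {zp zm : M}
    (hc : IsConvSeq g zp zm) (hg : ∀ k, g k ∈ G) (hinj : Function.Injective g) :
    zp ∈ limitSet G := ⟨g, hg, hinj, zm, hc⟩

theorem smul_mem_limitSet {G : Subgroup (M ≃ₜ M)} {h : M ≃ₜ M} (hh : h ∈ G) {z : M}
    (hz : z ∈ limitSet G) : h z ∈ limitSet G := by
  obtain ⟨g, hg, hinj, zm, hc⟩ := hz
  refine ⟨fun k => h * g k, fun k => G.mul_mem hh (hg k),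
    fun a b hab => hinj (mul_left_cancel hab), zm, fun K hK hzm U hU => ?_⟩
  exact hc K hK hzm (h ⁻¹' U) (h.continuous.continuousAt hU)

theorem smul_mem_limitSet_iff {G : Subgroup (M ≃ₜ M)} {h : M ≃ₜ M} (hh : h ∈ G) {z : M} :
    h z ∈ limitSet G ↔ z ∈ limitSet G := by
  refine ⟨fun hz => ?_, smul_mem_limitSet hh⟩
  have := smul_mem_limitSet (G.inv_mem hh) hz
  rwa [homeo_inv_apply_self] at this

theorem infinite_of_injective_homeo {g : ℕ → M ≃ₜ M} (hg : Function.Injective g) :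
    Infinite M := by
  by_contra hM
  rw [not_infinite_iff_finite] at hM
  have : Finite (M ≃ₜ M) := Finite.of_injective (fun h : M ≃ₜ M => (⇑h : M → M))
    DFunLike.coe_injective
  exact not_injective_infinite_finite g hg

/-- A sequence has a subsequence that is constant or injective modulo a transitive,
symmetric relation. -/
theorem exists_subseq_rel_or_not_rel {α : Type*} (r : α → α → Prop) [IsTrans α r]
    (hsymm : ∀ a b, r a b → r b a) (f : ℕ → α) :
    ∃ φ : ℕ → ℕ, StrictMono φ ∧
      ((∀ n, r (f (φ 0)) (f (φ (n + 1)))) ∨ ∀ m n, m ≠ n → ¬ r (f (φ m)) (f (φ n))) := by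
  obtain ⟨φ, hφ⟩ := exists_increasing_or_nonincreasing_subseq r f
  refine ⟨φ, φ.strictMono, hφ.imp (fun h n => h 0 (n + 1) n.succ_pos) fun h m n hmn => ?_⟩
  rcases lt_or_gt_of_ne hmn with h' | h'
  · exact h m n h'
  · exact fun hr => h n m h' (hsymm _ _ hr)

theorem exists_subseq_const_or_injective {α : Type*} (f : ℕ → α) :
    ∃ φ : ℕ → ℕ, StrictMono φ ∧ ((∃ a, ∀ n, f (φ n) = a) ∨ Function.Injective (f ∘ φ)) := by
  obtain ⟨φ, hφ, h⟩ := exists_subseq_rel_or_not_rel Eq (fun _ _ => Eq.symm) f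
  refine ⟨φ, hφ, h.imp (fun h => ⟨f (φ 0), fun n => ?_⟩) fun h m n hmn => ?_⟩
  · cases n with
    | zero => rfl
    | succ n => exact (h n).symm
  · by_contra hne
    exact h m n hne hmn

theorem IsParabolicElem.injective_pow [T2Space M] {g : M ≃ₜ M} (hg : IsParabolicElem g) :
    Function.Injective fun n : ℕ => g ^ n := by
  rw [injective_pow_iff_not_isOfFinOrder]
  intro hfin
  have hf : (Set.range fun n : ℤ => toCM (g ^ n)).Finite := by
    have h1 := (finite_zpowers.2 hfin)
    refine (Set.Finite.image toCM h1).subset ?_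
    rintro _ ⟨n, rfl⟩
    exact ⟨g ^ n, ⟨n, rfl⟩, rfl⟩
  refine hg.1 ⟨?_, ?_⟩
  · rw [hf.isClosed.closure_eq]
    exact hf.isCompact
  · rw [hf.isClosed.closure_eq]
    rintro _ ⟨n, rfl⟩
    exact ⟨g ^ n, rfl⟩

variable [CompactSpace M] [T2Space M]

theorem IsConvSeq.inv {g : ℕ → M ≃ₜ M} {zp zm : M} (hg : IsConvSeq g zp zm) :
    IsConvSeq (fun k => (g k)⁻¹) zm zp := by
  intro K hK hzp U hU
  have hU' : zm ∉ (interior U)ᶜ := fun h => h (mem_interior_iff_mem_nhds.2 hU)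
  filter_upwards [hg (interior U)ᶜ isOpen_interior.isClosed_compl.isCompact hU' Kᶜ
    (hK.isClosed.isOpen_compl.mem_nhds hzp)] with k hk x hx
  by_contra hxU
  have := hk ((g k)⁻¹ x) (fun h => hxU (interior_subset h))
  rw [homeo_apply_inv_self] at this
  exact this hx

theorem IsConvSeq.tendsto {g : ℕ → M ≃ₜ M} {zp zm : M} (hg : IsConvSeq g zp zm)
    {u : ℕ → M} {u₀ : M} (hu : Tendsto u atTop (𝓝 u₀)) (hne : u₀ ≠ zm) :
    Tendsto (fun k => g k (u k)) atTop (𝓝 zp) := by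
  obtain ⟨K, hKu, hKc, hK⟩ := exists_mem_nhds_isCompact_mapsTo (f := id) continuous_id
    (isOpen_compl_singleton.mem_nhds hne : ({zm}ᶜ : Set M) ∈ 𝓝 u₀)
  intro U hU
  show ∀ᶠ k in atTop, g k (u k) ∈ U
  filter_upwards [hg K hKc (fun h => hK h rfl) U hU, hu.eventually_mem hKu] with k hk hku
  exact hk _ hku

theorem IsConvSeq.tendsto_apply {g : ℕ → M ≃ₜ M} {zp zm : M} (hg : IsConvSeq g zp zm)
    {z : M} (hne : z ≠ zm) : Tendsto (fun k => g k z) atTop (𝓝 zp) :=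
  hg.tendsto tendsto_const_nhds hne

theorem IsConvSeq.mem_limitSet' {G : Subgroup (M ≃ₜ M)} {g : ℕ → M ≃ₜ M} {zp zm : M}
    (hc : IsConvSeq g zp zm) (hg : ∀ k, g k ∈ G) (hinj : Function.Injective g) :
    zm ∈ limitSet G :=
  ⟨fun k => (g k)⁻¹, fun k => G.inv_mem (hg k), fun _ _ h => hinj (inv_injective h), zp, hc.inv⟩

/-- The repelling point of a convergence sequence is not isolated. -/
theorem IsConvSeq.exists_ne_mem {g : ℕ → M ≃ₜ M} {zp zm : M} (hc : IsConvSeq g zp zm)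
    (hinj : Function.Injective g) {U : Set M} (hU : IsOpen U) (hne : U.Nonempty) :
    ∃ y ∈ U, y ≠ zm := by
  classical
  by_contra! h
  have hUz : U = {zm} := by
    obtain ⟨y, hy⟩ := hne
    ext x
    refine ⟨h x, fun hx => ?_⟩
    rw [mem_singleton_iff.1 hx, ← h y hy]
    exact hy
  have := infinite_of_injective_homeo hinj
  obtain ⟨u, hu⟩ := Infinite.exists_notMem_finset ({zp} : Finset M)
  obtain ⟨v, hv⟩ := Infinite.exists_notMem_finset ({zp, u} : Finset M)
  simp only [Finset.mem_insert, Finset.mem_singleton, not_or] at hu hv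
  have hUn : U ∈ 𝓝 zm := hU.mem_nhds (hUz ▸ mem_singleton zm)
  obtain ⟨k, hk1, hk2⟩ := ((hc.inv.tendsto_apply hu).eventually_mem hUn |>.and
    ((hc.inv.tendsto_apply hv.1).eventually_mem hUn)).exists
  have : (g k)⁻¹ v = (g k)⁻¹ u := (h _ hk2).trans (h _ hk1).symm
  exact hv.2 ((g k)⁻¹.injective this)

end Basic

section Discrete

variable {M : Type*} [TopologicalSpace M] [CompactSpace M] [T2Space M]

theorem IsDiscreteConvGroup.exists_subseq {G : Subgroup (M ≃ₜ M)} (hG : IsDiscreteConvGroup G)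
    {g : ℕ → M ≃ₜ M} (hg : ∀ k, g k ∈ G) (hinj : Function.Injective g) :
    ∃ φ : ℕ → ℕ, StrictMono φ ∧ ∃ zp ∈ limitSet G, ∃ zm ∈ limitSet G,
      IsConvSeq (g ∘ φ) zp zm := by
  obtain ⟨φ, hφ, zp, zm, hc⟩ := hG g hg hinj
  have h1 : ∀ k, (g ∘ φ) k ∈ G := fun k => hg _
  have h2 : Function.Injective (g ∘ φ) := hinj.comp hφ.injective
  exact ⟨φ, hφ, zp, hc.mem_limitSet h1 h2, zm, hc.mem_limitSet' h1 h2, hc⟩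

theorem IsDiscreteConvGroup.mem_limitSet_of_tendsto {G : Subgroup (M ≃ₜ M)}
    (hG : IsDiscreteConvGroup G) {p z : M} (hp : p ∉ limitSet G) {g : ℕ → M ≃ₜ M}
    (hg : ∀ k, g k ∈ G) (hinj : Function.Injective g)
    (hz : Tendsto (fun k => g k p) atTop (𝓝 z)) : z ∈ limitSet G := by
  obtain ⟨φ, hφ, zp, hzp, zm, hzm, hc⟩ := hG.exists_subseq hg hinj
  have h1 := hc.tendsto_apply (z := p) (fun h => hp (h ▸ hzm))
  rwa [tendsto_nhds_unique (hz.comp hφ.tendsto_atTop) h1]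

theorem infinite_setOf_apply_mem {G : Subgroup (M ≃ₜ M)} {p z : M} (hp : p ∉ limitSet G)
    (hz : z ∈ limitSet G) {U : Set M} (hU : U ∈ 𝓝 z) : {h | h ∈ G ∧ h p ∈ U}.Infinite := by
  obtain ⟨g, hg, hinj, zm, hc⟩ := hz
  have h1 := hc.tendsto_apply (z := p) (fun h => hp (h ▸ hc.mem_limitSet' hg hinj))
  obtain ⟨N, hN⟩ := eventually_atTop.1 (h1.eventually_mem hU)
  refine Set.infinite_of_injective_forall_mem (f := fun k => g (k + N))
    (fun a b hab => ?_) fun k => ⟨hg _, hN _ (by omega)⟩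
  simpa using hinj hab

end Discrete

section MetricDiscrete

variable {M : Type*} [MetricSpace M] [CompactSpace M]

theorem IsDiscreteConvGroup.isClosed_limitSet {G : Subgroup (M ≃ₜ M)}
    (hG : IsDiscreteConvGroup G) {p : M} (hp : p ∉ limitSet G) : IsClosed (limitSet G) := by
  classical
  refine isClosed_of_closure_subset fun z hz => ?_
  have hinf : ∀ n : ℕ, {h | h ∈ G ∧ h p ∈ Metric.ball z (1 / ((n : ℝ) + 1))}.Infinite := by
    intro n
    obtain ⟨y, hy, hyz⟩ := mem_closure_iff.1 hz _ Metric.isOpen_ball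
      (Metric.mem_ball_self (Nat.one_div_pos_of_nat (n := n) (α := ℝ)))
    exact infinite_setOf_apply_mem hp hyz (Metric.isOpen_ball.mem_nhds hy)
  obtain ⟨f, hf, hf'⟩ := exists_seq_of_forall_finset_exists
    (fun x : ℕ × (M ≃ₜ M) => x.2 ∈ G ∧ x.2 p ∈ Metric.ball z (1 / ((x.1 : ℝ) + 1)))
    (fun x y => x.1 < y.1 ∧ x.2 ≠ y.2) (fun s _ => by
      obtain ⟨h, hh, hhs⟩ := (hinf (s.sup Prod.fst + 1)).exists_notMem_finset (s.image Prod.snd)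
      refine ⟨(s.sup Prod.fst + 1, h), hh, fun x hx => ⟨?_, fun hxe => hhs ?_⟩⟩
      · exact Nat.lt_succ_of_le (Finset.le_sup (f := Prod.fst) hx)
      · exact Finset.mem_image.2 ⟨x, hx, hxe⟩)
  refine hG.mem_limitSet_of_tendsto hp (g := fun n => (f n).2) (fun n => (hf n).1) ?_ ?_
  · intro a b hab
    by_contra hne
    rcases lt_or_gt_of_ne hne with h | h
    · exact (hf' a b h).2 hab
    · exact (hf' b a h).2 hab.symm
  · have hmono : StrictMono fun n => (f n).1 := fun a b hab => (hf' a b hab).1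
    rw [tendsto_iff_dist_tendsto_zero]
    refine squeeze_zero (fun _ => dist_nonneg) (fun n => (Metric.mem_ball.1 (hf n).2).le) ?_
    exact (tendsto_one_div_add_atTop_nhds_zero_nat (𝕜 := ℝ)).comp hmono.tendsto_atTop

theorem IsDiscreteConvGroup.crossing_finite {J : Subgroup (M ≃ₜ M)}
    (hJ : IsDiscreteConvGroup J) {p : M} (hp : p ∉ limitSet J) {A B : Set M} (hA : IsClosed A)
    (hB : IsClosed B) (hAB : ∀ r ∈ A, r ∈ B → r ∉ limitSet J) {ε : ℝ} (hε : 0 < ε) :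
    {h | h ∈ J ∧ ¬ MapsTo h A (Metric.ball (h p) ε) ∧
      ¬ MapsTo h B (Metric.ball (h p) ε)}.Finite := by
  by_contra hinf
  let e := Set.Infinite.natEmbedding _ hinf
  obtain ⟨φ, -, zp, -, zm, hzm, hc⟩ := hJ.exists_subseq (g := fun n => (e n : M ≃ₜ M))
    (fun k => (e k).2.1) (fun a b h => e.injective (Subtype.ext h))
  have hev : ∀ C : Set M, IsClosed C → zm ∉ C →
      ∃ k, MapsTo (e k : M ≃ₜ M) C (Metric.ball ((e k : M ≃ₜ M) p) ε) := by
    intro C hC hzC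
    obtain ⟨k, hk1, hk2⟩ := ((hc C hC.isCompact hzC _ (Metric.ball_mem_nhds zp (half_pos hε))).and
      ((hc.tendsto_apply (z := p) (fun h => hp (h ▸ hzm))).eventually_mem
        (Metric.ball_mem_nhds zp (half_pos hε)))).exists
    refine ⟨φ k, fun x hx => ?_⟩
    have h1 := Metric.mem_ball.1 (hk1 x hx)
    have h2 := Metric.mem_ball'.1 hk2
    rw [Metric.mem_ball]
    calc _ ≤ _ := dist_triangle _ zp _
      _ < ε / 2 + ε / 2 := add_lt_add h1 h2
      _ = ε := add_halves ε
  by_cases hzA : zm ∈ A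
  · obtain ⟨k, hk⟩ := hev B hB (fun h => hAB zm hzA h hzm)
    exact (e k).2.2.2 hk
  · obtain ⟨k, hk⟩ := hev A hA hzA
    exact (e k).2.2.1 hk

/-- Scales decreasing so fast that an element which contracts neither member of one of the first
`l` pairs at scale `l` keeps `p` farther than `ρ (l + 1)` away from the limit set. -/
theorem IsDiscreteConvGroup.exists_scales {J : Subgroup (M ≃ₜ M)}
    (hJ : IsDiscreteConvGroup J) {p : M} (hp : p ∉ limitSet J) (q : ℕ → Set M × Set M)
    (hq : ∀ n, IsClosed (q n).1 ∧ IsClosed (q n).2 ∧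
      ∀ r ∈ (q n).1, r ∈ (q n).2 → r ∉ limitSet J) :
    ∃ ρ : ℕ → ℝ, (∀ l, 0 < ρ l) ∧ (∀ l, ρ (l + 1) ≤ ρ l / 4) ∧ ∀ l, ∀ n ≤ l, ∀ h ∈ J,
      ¬ MapsTo h (q n).1 (Metric.ball (h p) (ρ l / 4)) →
      ¬ MapsTo h (q n).2 (Metric.ball (h p) (ρ l / 4)) →
      ∀ z ∈ limitSet J, ρ (l + 1) < dist (h p) z := by
  have step : ∀ (l : ℕ) (r : {r : ℝ // 0 < r}), ∃ r' : {r : ℝ // 0 < r}, (r' : ℝ) ≤ r / 4 ∧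
      ∀ n ≤ l, ∀ h ∈ J,
      ¬ MapsTo h (q n).1 (Metric.ball (h p) (r / 4)) →
      ¬ MapsTo h (q n).2 (Metric.ball (h p) (r / 4)) →
      ∀ z ∈ limitSet J, r' < dist (h p) z := by
    rintro l ⟨r, hr⟩
    have hfin : (⋃ n ∈ Iic l, {h | h ∈ J ∧ ¬ MapsTo h (q n).1 (Metric.ball (h p) (r / 4)) ∧
      ¬ MapsTo h (q n).2 (Metric.ball (h p) (r / 4))}).Finite :=
      (finite_Iic l).biUnion fun n _ =>
        hJ.crossing_finite hp (hq n).1 (hq n).2.1 (hq n).2.2 (by linarith)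
    have hev : ∀ᶠ r' in 𝓝[>] (0 : ℝ), ∀ h ∈ (⋃ n ∈ Iic l,
        {h | h ∈ J ∧ ¬ MapsTo h (q n).1 (Metric.ball (h p) (r / 4)) ∧
        ¬ MapsTo h (q n).2 (Metric.ball (h p) (r / 4))}),
        ∀ z ∈ limitSet J, r' < dist (h p) z := by
      rw [Filter.eventually_all_finite hfin]
      intro h hh
      simp only [mem_iUnion, mem_ofPred_eq] at hh
      obtain ⟨n, -, hhJ, -⟩ := hh
      obtain ⟨ε, hε, hball⟩ := Metric.isOpen_iff.1 (hJ.isClosed_limitSet hp).isOpen_compl (h p)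
        (fun h' => hp ((smul_mem_limitSet_iff hhJ).1 h'))
      filter_upwards [Ioo_mem_nhdsGT hε] with r' hr' z hz
      by_contra! hle
      exact hball (Metric.mem_ball'.2 (hle.trans_lt hr'.2)) hz
    obtain ⟨r', hr', hr''⟩ := (hev.and (Ioo_mem_nhdsGT (show (0 : ℝ) < r / 4 by linarith))).exists
    refine ⟨⟨r', hr''.1⟩, hr''.2.le, fun n hn h hh h1 h2 => hr' h ?_⟩
    simp only [mem_iUnion]
    exact ⟨n, hn, hh, h1, h2⟩
  choose f hf hf' using step
  let ρ : ℕ → {r : ℝ // 0 < r} := fun l => Nat.rec ⟨1, one_pos⟩ (fun l r => f l r) l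
  exact ⟨fun l => (ρ l).1, fun l => (ρ l).2, fun l => hf l (ρ l), fun l => hf' l (ρ l)⟩

end MetricDiscrete

section Chains

variable {M : Type*} [MetricSpace M]

/-- The closed inner neighbourhood attached to a triple `(h, l, z)`: the points that `h` moves
within `ρ (l + 1)` of `z`. -/
def innerSet (ρ : ℕ → ℝ) (e : (M ≃ₜ M) × ℕ × M) : Set M :=
  {y | dist (e.1 y) e.2.2 ≤ ρ (e.2.1 + 1)}

/-- The open outer neighbourhood attached to a triple `(h, l, z)`: the points that `h` moves
within `ρ l / 2` of `z`. -/
def outerSet (ρ : ℕ → ℝ) (e : (M ≃ₜ M) × ℕ × M) : Set M :=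
  {y | dist (e.1 y) e.2.2 < ρ e.2.1 / 2}

/-- A finite nested family of annuli `outerSet ρ e \ innerSet ρ e` separating `A` from the
complement of `N`. -/
structure IsSepChain (J : Subgroup (M ≃ₜ M)) (ρ : ℕ → ℝ) (Z : ℕ → Finset M) (A N : Set M)
    (s : Finset ((M ≃ₜ M) × ℕ × M)) : Prop where
  mem : ∀ e ∈ s, e.1 ∈ J ∧ e.2.2 ∈ Z e.2.1
  inner : ∀ e ∈ s, A ⊆ innerSet ρ e
  outer : ∀ e ∈ s, outerSet ρ e ⊆ N
  nested : ∀ e ∈ s, ∀ e' ∈ s, e ≠ e' →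
    outerSet ρ e ⊆ innerSet ρ e' ∨ outerSet ρ e' ⊆ innerSet ρ e

/-- There is a separating chain of length at least `n`. -/
def HasSepChain (J : Subgroup (M ≃ₜ M)) (ρ : ℕ → ℝ) (Z : ℕ → Finset M) (A N : Set M)
    (n : ℕ) : Prop :=
  ∃ s, IsSepChain J ρ Z A N s ∧ n ≤ s.card

/-- The triples in `J` that are centred near the orbit point of `p` and contract neither `A`
nor `B`. -/
def crossingTriples (J : Subgroup (M ≃ₜ M)) (ρ : ℕ → ℝ) (Z : ℕ → Finset M) (p : M)
    (A B : Set M) : Set ((M ≃ₜ M) × ℕ × M) :=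
  {e | e.1 ∈ J ∧ e.2.2 ∈ Z e.2.1 ∧ p ∈ innerSet ρ e ∧ ¬ A ⊆ outerSet ρ e ∧
    ¬ B ⊆ outerSet ρ e}

theorem innerSet_subset_outerSet {ρ : ℕ → ℝ} (hρ : ∀ l, 0 < ρ l)
    (hρ' : ∀ l, ρ (l + 1) ≤ ρ l / 4) (e : (M ≃ₜ M) × ℕ × M) : innerSet ρ e ⊆ outerSet ρ e := by
  intro y hy
  have h1 := hρ e.2.1
  have h2 := hρ' e.2.1
  have h3 : dist (e.1 y) e.2.2 ≤ ρ (e.2.1 + 1) := hy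
  show dist (e.1 y) e.2.2 < ρ e.2.1 / 2
  linarith

theorem crossingTriples_finite [CompactSpace M] {J : Subgroup (M ≃ₜ M)}
    (hJ : IsDiscreteConvGroup J) {p : M} (hp : p ∉ limitSet J) {ρ : ℕ → ℝ}
    (hρ : ∀ l, 0 < ρ l) (hρ' : ∀ l, ρ (l + 1) ≤ ρ l / 4)
    {Z : ℕ → Finset M} (hZ : ∀ l, ∀ z ∈ Z l, z ∈ limitSet J) {A B : Set M} (hA : IsClosed A)
    (hB : IsClosed B) (hAB : ∀ r ∈ A, r ∈ B → r ∉ limitSet J) {n : ℕ}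
    (hsc : ∀ l, n ≤ l → ∀ h ∈ J, ¬ MapsTo h A (Metric.ball (h p) (ρ l / 4)) →
      ¬ MapsTo h B (Metric.ball (h p) (ρ l / 4)) →
      ∀ z ∈ limitSet J, ρ (l + 1) < dist (h p) z) :
    (crossingTriples J ρ Z p A B).Finite := by
  have key : ∀ e ∈ crossingTriples J ρ Z p A B, ∀ C : Set M, ¬ C ⊆ outerSet ρ e →
      ¬ MapsTo e.1 C (Metric.ball (e.1 p) (ρ e.2.1 / 4)) := by
    rintro e ⟨-, -, hpe, -, -⟩ C hC hmap
    refine hC fun y hy => ?_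
    have h1 := Metric.mem_ball.1 (hmap hy)
    have h2 : dist (e.1 p) e.2.2 ≤ ρ (e.2.1 + 1) := hpe
    have h3 := hρ' e.2.1
    have h4 := dist_triangle (e.1 y) (e.1 p) e.2.2
    show dist (e.1 y) e.2.2 < ρ e.2.1 / 2
    linarith
  have hfin : (⋃ l ∈ Iio n, {h | h ∈ J ∧ ¬ MapsTo h A (Metric.ball (h p) (ρ l / 4)) ∧
      ¬ MapsTo h B (Metric.ball (h p) (ρ l / 4))} ×ˢ ({l} ×ˢ (Z l : Set M))).Finite :=
    (finite_Iio n).biUnion fun l _ =>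
      (hJ.crossing_finite hp hA hB hAB (by linarith [hρ l])).prod
        ((finite_singleton l).prod (Z l).finite_toSet)
  refine hfin.subset fun e he => ?_
  have h1 := key e he A he.2.2.2.1
  have h2 := key e he B he.2.2.2.2
  have hl : e.2.1 < n := by
    by_contra! hle
    exact absurd (show dist (e.1 p) e.2.2 ≤ ρ (e.2.1 + 1) from he.2.2.1)
      (not_le.2 (hsc _ hle _ he.1 h1 h2 _ (hZ _ _ he.2.1)))
  simp only [mem_iUnion]
  exact ⟨e.2.1, hl, ⟨he.1, h1, h2⟩, rfl, he.2.1⟩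

variable {J : Subgroup (M ≃ₜ M)} {ρ : ℕ → ℝ} {Z : ℕ → Finset M}

theorem hasSepChain_zero (A N : Set M) : HasSepChain J ρ Z A N 0 :=
  ⟨∅, ⟨by simp, by simp, by simp, by simp⟩, Nat.zero_le _⟩

theorem HasSepChain.mono {A N N' : Set M} {m n : ℕ} (h : HasSepChain J ρ Z A N n) (hmn : m ≤ n)
    (hN : N ⊆ N') : HasSepChain J ρ Z A N' m := by
  obtain ⟨s, hs, hc⟩ := h
  exact ⟨s, ⟨hs.mem, hs.inner, fun e he => (hs.outer e he).trans hN, hs.nested⟩, hmn.trans hc⟩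

theorem HasSepChain.preimage {A N : Set M} {n : ℕ} (h : HasSepChain J ρ Z A N n) {g : M ≃ₜ M}
    (hg : g ∈ J) : HasSepChain J ρ Z (g ⁻¹' A) (g ⁻¹' N) n := by
  classical
  obtain ⟨s, hs, hc⟩ := h
  have hinj : Function.Injective
      (fun e : (M ≃ₜ M) × ℕ × M => ((e.1 * g, e.2) : (M ≃ₜ M) × ℕ × M)) := by
    rintro ⟨a, b⟩ ⟨a', b'⟩ h
    simpa using h
  have hnest : ∀ e e' : (M ≃ₜ M) × ℕ × M, outerSet ρ e ⊆ innerSet ρ e' →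
      outerSet ρ (e.1 * g, e.2) ⊆ innerSet ρ (e'.1 * g, e'.2) :=
    fun e e' h y hy => h (show g y ∈ outerSet ρ e from hy)
  refine ⟨s.image fun e => (e.1 * g, e.2), ⟨?_, ?_, ?_, ?_⟩, ?_⟩
  · simp only [Finset.forall_mem_image]
    exact fun e he => ⟨J.mul_mem (hs.mem e he).1 hg, (hs.mem e he).2⟩
  · simp only [Finset.forall_mem_image]
    exact fun e he y hy => hs.inner e he hy
  · simp only [Finset.forall_mem_image]
    exact fun e he y hy => hs.outer e he (show g y ∈ outerSet ρ e from hy)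
  · simp only [Finset.forall_mem_image]
    intro e he e' he' hne
    exact (hs.nested e he e' he' fun h => hne (by rw [h])).imp (hnest _ _) (hnest _ _)
  · rwa [Finset.card_image_of_injective _ hinj]

/-- Concatenation of separating chains. -/
theorem HasSepChain.append (hρ : ∀ l, 0 < ρ l) (hρ' : ∀ l, ρ (l + 1) ≤ ρ l / 4)
    {A N' N N'' : Set M} {m n : ℕ} (h1 : HasSepChain J ρ Z A N' m)
    (h2 : HasSepChain J ρ Z N N'' n) (hAN : A ⊆ N) (hN' : N' ⊆ N) (hN : N ⊆ N'')
    (hNN' : ¬ N ⊆ N') : HasSepChain J ρ Z A N'' (m + n) := by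
  classical
  obtain ⟨s, hs, hsc⟩ := h1
  obtain ⟨t, ht, htc⟩ := h2
  have hst : ∀ e ∈ s, ∀ e' ∈ t, outerSet ρ e ⊆ innerSet ρ e' := fun e he e' he' =>
    (hs.outer e he).trans (hN'.trans (ht.inner e' he'))
  have hdisj : Disjoint s t := by
    rw [Finset.disjoint_left]
    intro e he he'
    exact hNN' ((ht.inner e he').trans
      ((innerSet_subset_outerSet hρ hρ' e).trans (hs.outer e he)))
  refine ⟨s ∪ t, ⟨?_, ?_, ?_, ?_⟩, ?_⟩
  · intro e he
    exact (Finset.mem_union.1 he).elim (hs.mem e) (ht.mem e)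
  · intro e he
    exact (Finset.mem_union.1 he).elim (hs.inner e) fun h => hAN.trans (ht.inner e h)
  · intro e he
    exact (Finset.mem_union.1 he).elim (fun h => (hs.outer e h).trans (hN'.trans hN)) (ht.outer e)
  · intro e he e' he' hne
    rcases Finset.mem_union.1 he with h | h <;> rcases Finset.mem_union.1 he' with h' | h'
    · exact hs.nested e h e' h' hne
    · exact Or.inl (hst e h e' h')
    · exact Or.inr (hst e' h' e h)
    · exact ht.nested e h e' h' hne
  · rw [Finset.card_union_of_disjoint hdisj]
    omega

/-- A chain starting at `p` and ending before `y ∈ A` loses only boundedly many members when it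
is asked to start at `B`. -/
theorem HasSepChain.restrict {p y : M}
    {A B : Set M} (hfin : (crossingTriples J ρ Z p A B).Finite) (hy : y ∈ A) {n : ℕ}
    (h : HasSepChain J ρ Z {p} {y}ᶜ n) :
    HasSepChain J ρ Z B {y}ᶜ (n - (1 + (crossingTriples J ρ Z p A B).ncard)) := by
  classical
  obtain ⟨s, hs, hsc⟩ := h
  refine ⟨s.filter fun e => B ⊆ innerSet ρ e, ⟨?_, ?_, ?_, ?_⟩, ?_⟩
  · exact fun e he => hs.mem e (Finset.mem_filter.1 he).1
  · exact fun e he => (Finset.mem_filter.1 he).2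
  · exact fun e he => hs.outer e (Finset.mem_filter.1 he).1
  · exact fun e he e' he' => hs.nested e (Finset.mem_filter.1 he).1 e' (Finset.mem_filter.1 he').1
  · have hbad : ((s.filter fun e => ¬ B ⊆ innerSet ρ e).filter fun e => B ⊆ outerSet ρ e).card
        ≤ 1 := by
      rw [Finset.card_le_one]
      intro e he e' he'
      simp only [Finset.mem_filter] at he he'
      by_contra hne
      rcases hs.nested e he.1.1 e' he'.1.1 hne with h | h
      · exact he'.1.2 (he.2.trans h)
      · exact he.1.2 (he'.2.trans h)
    have hbad' : ((s.filter fun e => ¬ B ⊆ innerSet ρ e).filter fun e => ¬ B ⊆ outerSet ρ e).card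
        ≤ (crossingTriples J ρ Z p A B).ncard := by
      rw [← Set.ncard_coe_finset]
      refine Set.ncard_le_ncard (fun e he => ?_) hfin
      simp only [Finset.coe_filter, Finset.mem_filter, mem_ofPred_eq] at he
      refine ⟨(hs.mem e he.1.1).1, (hs.mem e he.1.1).2, hs.inner e he.1.1 rfl, fun hA => ?_, he.2⟩
      exact hs.outer e he.1.1 (hA hy) rfl
    have h1 := Finset.card_filter_add_card_filter_not (s := s) (fun e => B ⊆ innerSet ρ e)
    have h2 := Finset.card_filter_add_card_filter_not
      (s := s.filter fun e => ¬ B ⊆ innerSet ρ e) (fun e => B ⊆ outerSet ρ e)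
    omega

theorem HasSepChain.le_ncard {p y : M}
    (hfin : (crossingTriples J ρ Z p {y} {y}).Finite) {n : ℕ}
    (h : HasSepChain J ρ Z {p} {y}ᶜ n) : n ≤ (crossingTriples J ρ Z p {y} {y}).ncard := by
  obtain ⟨s, hs, hsc⟩ := h
  refine hsc.trans ?_
  rw [← Set.ncard_coe_finset]
  refine Set.ncard_le_ncard (fun e he => ?_) hfin
  have h1 : ¬ {y} ⊆ outerSet ρ e := fun h => hs.outer e he (h rfl) rfl
  exact ⟨(hs.mem e he).1, (hs.mem e he).2, hs.inner e he rfl, h1, h1⟩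

theorem exists_nhds_hasSepChain (hρ : ∀ l, 0 < ρ l) (hρ' : ∀ l, ρ (l + 1) ≤ ρ l / 4) {b : M}
    (hZ : ∀ l, ∃ z ∈ Z l, dist b z < ρ (l + 1) / 4) {N : Set M} (hN : N ∈ 𝓝 b) (L : ℕ) :
    ∃ V ∈ 𝓝 b, ∀ p ∈ V, HasSepChain J ρ Z {p} N L := by
  classical
  choose z hz hbz using hZ
  obtain ⟨ε, hε, hball⟩ := Metric.mem_nhds_iff.1 hN
  have hanti : Antitone ρ := antitone_nat_of_succ_le fun l => by linarith [hρ l, hρ' l]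
  have hpow : ∀ l, ρ l ≤ ρ 0 * (1 / 4) ^ l := by
    intro l
    induction l with
    | zero => simp
    | succ l ih => rw [pow_succ]; linarith [hρ' l]
  obtain ⟨l₀, hl₀⟩ : ∃ l₀, ρ l₀ < ε := by
    have h1 : Tendsto (fun l : ℕ => ρ 0 * (1 / 4 : ℝ) ^ l) atTop (𝓝 (ρ 0 * 0)) :=
      (tendsto_pow_atTop_nhds_zero_of_lt_one (by norm_num) (by norm_num)).const_mul _
    rw [mul_zero] at h1
    obtain ⟨l, hl⟩ := (h1.eventually_lt_const hε).exists
    exact ⟨l, (hpow l).trans_lt hl⟩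
  have hnest : ∀ l l', l < l' →
      outerSet ρ ((1 : M ≃ₜ M), l', z l') ⊆ innerSet ρ ((1 : M ≃ₜ M), l, z l) := by
    intro l l' hll' y hy
    have h1 : dist y (z l') < ρ l' / 2 := hy
    have h2 := hbz l'
    have h3 := hbz l
    have h4 := hanti (Nat.succ_le_of_lt hll')
    have h5 := hρ' l'
    have h6 := dist_triangle4_right y (z l) b (z l')
    have h7 := dist_triangle y (z l') (z l)
    have h8 := dist_triangle (z l') b (z l)
    rw [dist_comm (z l') b] at h8
    show dist y (z l) ≤ ρ (l + 1)
    simp only [Nat.succ_eq_add_one] at h4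
    linarith [hρ l']
  refine ⟨Metric.ball b (ρ (l₀ + L) / 4), Metric.ball_mem_nhds b (by linarith [hρ (l₀ + L)]),
    fun p hp => ?_⟩
  have hinj : Function.Injective fun l : ℕ => ((1 : M ≃ₜ M), l, z l) := by
    intro l l' h
    exact (Prod.ext_iff.1 (Prod.ext_iff.1 h).2).1
  refine ⟨(Finset.Ico l₀ (l₀ + L)).image fun l => ((1 : M ≃ₜ M), l, z l), ⟨?_, ?_, ?_, ?_⟩, ?_⟩
  · simp only [Finset.forall_mem_image]
    exact fun l _ => ⟨J.one_mem, hz l⟩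
  · simp only [Finset.forall_mem_image]
    intro l hl y hy
    rw [mem_singleton_iff.1 hy]
    have h1 := Metric.mem_ball.1 hp
    have h2 := hanti (Nat.succ_le_of_lt (Finset.mem_Ico.1 hl).2)
    have h3 := dist_triangle p b (z l)
    show dist p (z l) ≤ ρ (l + 1)
    simp only [Nat.succ_eq_add_one] at h2
    linarith [hbz l, hρ (l + 1)]
  · simp only [Finset.forall_mem_image]
    intro l hl y hy
    have h1 : dist y (z l) < ρ l / 2 := hy
    have h2 := hanti (Finset.mem_Ico.1 hl).1
    have h3 := dist_triangle_right y b (z l)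
    refine hball (Metric.mem_ball.2 ?_)
    linarith [hbz l, hρ l, hρ' l]
  · simp only [Finset.forall_mem_image]
    intro l _ l' _ hne
    rcases lt_trichotomy l l' with h | h | h
    · exact Or.inr (hnest l l' h)
    · exact absurd (by rw [h]) hne
    · exact Or.inl (hnest l' l h)
  · rw [Finset.card_image_of_injective _ hinj, Nat.card_Ico]
    omega

end Chains

section Normalize

variable {M : Type*} [TopologicalSpace M] [CompactSpace M] [TopologicalSpace.MetrizableSpace M]

/-- A countable family of pairs of closed sets, disjoint on the limit set, that separates points
and contains the prescribed pairs of singletons. -/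
theorem exists_separating_pairs {Λ : Set M} {w : ℕ → M} (hw : ∀ k, w k ∉ Λ) :
    ∃ q : ℕ → Set M × Set M, (∀ n, IsClosed (q n).1 ∧ IsClosed (q n).2 ∧
      ∀ r ∈ (q n).1, r ∈ (q n).2 → r ∉ Λ) ∧ (∀ k, ∃ n, q n = ({w k}, {w k})) ∧
      ∀ a b, a ≠ b → ∃ n, (q n).1 ∈ 𝓝 a ∧ (q n).2 ∈ 𝓝 b ∧ Disjoint (q n).1 (q n).2 := by
  let _ := TopologicalSpace.metrizableSpaceMetric M
  have : SecondCountableTopology M := EMetric.secondCountable_of_sigmaCompact M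
  let S : Set (Set M × Set M) := range (fun k => (({w k}, {w k}) : Set M × Set M)) ∪
    (fun U : Set M × Set M => (closure U.1, closure U.2)) ''
      {U | (U.1 ∈ TopologicalSpace.countableBasis M ∧ U.2 ∈ TopologicalSpace.countableBasis M) ∧
        Disjoint (closure U.1) (closure U.2)}
  have hS : S.Countable := (countable_range _).union
    ((((TopologicalSpace.countable_countableBasis M).prod
      (TopologicalSpace.countable_countableBasis M)).mono fun U hU => hU.1).image _)
  obtain ⟨q, hq⟩ := hS.exists_eq_range ⟨_, Or.inl ⟨0, rfl⟩⟩
  have hmem : ∀ n, q n ∈ S := fun n => hq ▸ mem_range_self n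
  refine ⟨q, fun n => ?_, fun k => ?_, fun a b hab => ?_⟩
  · rcases hmem n with ⟨k, hk⟩ | ⟨U, ⟨-, hU⟩, hk⟩
    · rw [← hk]
      exact ⟨isClosed_singleton, isClosed_singleton, fun r hr _ => mem_singleton_iff.1 hr ▸ hw k⟩
    · rw [← hk]
      exact ⟨isClosed_closure, isClosed_closure, fun r hr hr' =>
        (Set.disjoint_left.1 hU hr hr').elim⟩
  · have : (({w k}, {w k}) : Set M × Set M) ∈ S := Or.inl ⟨k, rfl⟩
    rwa [hq] at this
  · obtain ⟨U, haU, hU, V, hbV, hV, hUV⟩ := exists_open_nhds_disjoint_closure hab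
    obtain ⟨U', hU', haU', hUU'⟩ :=
      (TopologicalSpace.isBasis_countableBasis M).exists_subset_of_mem_open haU hU
    obtain ⟨V', hV', hbV', hVV'⟩ :=
      (TopologicalSpace.isBasis_countableBasis M).exists_subset_of_mem_open hbV hV
    have hd := hUV.mono (closure_mono hUU') (closure_mono hVV')
    have : ((closure U', closure V') : Set M × Set M) ∈ S :=
      Or.inr ⟨(U', V'), ⟨⟨hU', hV'⟩, hd⟩, rfl⟩
    rw [hq] at this
    obtain ⟨n, hn⟩ := this
    refine ⟨n, ?_⟩
    rw [hn]
    exact ⟨mem_of_superset (((TopologicalSpace.isBasis_countableBasis M).isOpen hU').mem_nhds haU')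
      subset_closure, mem_of_superset (((TopologicalSpace.isBasis_countableBasis M).isOpen
        hV').mem_nhds hbV') subset_closure, hd⟩

/-- The points `w k` off the limit set of `J` can be moved by elements of `J` so that no element
of `J` brings the base point `p` near a limit point `b` while taking a moved point near another
point `a`. -/
theorem IsDiscreteConvGroup.exists_normalization {J : Subgroup (M ≃ₜ M)}
    (hJ : IsDiscreteConvGroup J) {p : M} (hp : p ∉ limitSet J) {w : ℕ → M}
    (hw : ∀ k, w k ∉ limitSet J) :
    ∃ j : ℕ → M ≃ₜ M, (∀ k, j k ∈ J) ∧ ∀ a b, b ∈ limitSet J → a ≠ b →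
      ∃ U ∈ 𝓝 a, ∃ V ∈ 𝓝 b, ∀ k, ∀ g ∈ J, g p ∈ V → g (j k (w k)) ∉ U := by
  classical
  let _ := TopologicalSpace.metrizableSpaceMetric M
  obtain ⟨q, hq, hqw, hqsep⟩ := exists_separating_pairs hw
  obtain ⟨ρ, hρ, hρ', hsc⟩ := hJ.exists_scales hp q hq
  have hcomp : IsCompact (limitSet J) := (hJ.isClosed_limitSet hp).isCompact
  have hnet : ∀ l, ∃ Z : Finset M, (∀ z ∈ Z, z ∈ limitSet J) ∧
      ∀ b ∈ limitSet J, ∃ z ∈ Z, dist b z < ρ (l + 1) / 4 := by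
    intro l
    obtain ⟨t, ht, htf, hcov⟩ := hcomp.finite_cover_balls
      (show (0 : ℝ) < ρ (l + 1) / 4 by linarith [hρ (l + 1)])
    refine ⟨htf.toFinset, fun z hz => ht (htf.mem_toFinset.1 hz), fun b hb => ?_⟩
    have := hcov hb
    simp only [mem_iUnion] at this
    obtain ⟨z, hz, hbz⟩ := this
    exact ⟨z, htf.mem_toFinset.2 hz, hbz⟩
  choose Z hZ hZ' using hnet
  have hfin : ∀ n, (crossingTriples J ρ Z p (q n).1 (q n).2).Finite := fun n =>
    crossingTriples_finite hJ hp hρ hρ' hZ (hq n).1 (hq n).2.1 (hq n).2.2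
      (fun l hl => hsc l n hl)
  have hbdd : ∀ k, ∃ n, ∃ j ∈ J, ¬ HasSepChain J ρ Z {p} {j (w k)}ᶜ (n + 1) := by
    intro k
    obtain ⟨n, hn⟩ := hqw k
    have hf := hfin n
    rw [hn] at hf
    refine ⟨(crossingTriples J ρ Z p {w k} {w k}).ncard, 1, J.one_mem, fun h => ?_⟩
    exact absurd (HasSepChain.le_ncard hf h) (Nat.not_succ_le_self _)
  choose j hj hjn using fun k => Nat.find_spec (hbdd k)
  have hmin : ∀ k, ∀ h ∈ J, HasSepChain J ρ Z {p} {h (w k)}ᶜ (Nat.find (hbdd k)) := by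
    intro k h hh
    rcases Nat.eq_zero_or_pos (Nat.find (hbdd k)) with h0 | h0
    · rw [h0]
      exact hasSepChain_zero _ _
    · by_contra hno
      refine Nat.find_min (hbdd k) (Nat.sub_lt h0 one_pos) ⟨h, hh, ?_⟩
      rwa [show Nat.find (hbdd k) - 1 + 1 = Nat.find (hbdd k) from Nat.sub_add_cancel h0]
  refine ⟨j, hj, fun a b hb hab => ?_⟩
  obtain ⟨n, hA, hB, hdisj⟩ := hqsep a b hab
  obtain ⟨u, ⟨h, hh, rfl⟩, huB⟩ : ∃ u, (∃ h ∈ J, h p = u) ∧ u ∈ (q n).2 := by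
    obtain ⟨h, hh, hhB⟩ := (infinite_setOf_apply_mem hp hb hB).nonempty
    exact ⟨h p, ⟨h, hh, rfl⟩, hhB⟩
  have hub : b ≠ h p := fun he => hp ((smul_mem_limitSet_iff hh).1 (he ▸ hb))
  obtain ⟨V, hV, hVgain⟩ := exists_nhds_hasSepChain (J := J) hρ hρ' (fun l => hZ' l b hb)
    (inter_mem hB (isOpen_compl_singleton.mem_nhds hub : ({h p}ᶜ : Set M) ∈ 𝓝 b))
    (1 + (crossingTriples J ρ Z p (q n).1 (q n).2).ncard + 1)
  refine ⟨(q n).1, hA, V ∩ (q n).2, inter_mem hV hB, fun k g hg hgV hgA => hjn k ?_⟩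
  have h1 : HasSepChain J ρ Z (q n).2 {g (j k (w k))}ᶜ _ :=
    (hmin k (g * j k) (J.mul_mem hg (hj k))).restrict (hfin n) hgA
  have h2 := (hVgain (g p) hgV.1).append hρ hρ' h1 (singleton_subset_iff.2 hgV.2)
    inter_subset_left (fun y hy he => Set.disjoint_left.1 hdisj hgA (mem_singleton_iff.1 he ▸ hy))
    (fun hsub => (hsub huB).2 rfl)
  have h3 := h2.preimage hg
  have e1 : (g ⁻¹' {g p} : Set M) = {p} := by
    ext y; simp
  have e2 : (g ⁻¹' {g (j k (w k))}ᶜ : Set M) = {j k (w k)}ᶜ := by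
    ext y; simp
  rw [e1, e2] at h3
  exact h3.mono (by omega) subset_rfl

end Normalize

section Conical

variable {M : Type*} [TopologicalSpace M] [CompactSpace M] [TopologicalSpace.MetrizableSpace M]

theorem IsConvSeq.isConicalLimitPt {G : Subgroup (M ≃ₜ M)} {g : ℕ → M ≃ₜ M} {zp zm s : M}
    (hc : IsConvSeq g zp zm) (hg : ∀ k, g k ∈ G) (hinj : Function.Injective g)
    (hs : Tendsto (fun k => g k zm) atTop (𝓝 s)) (hne : s ≠ zp) : IsConicalLimitPt G zm := by
  refine ⟨g, hg, hinj, fun z hz => ?_⟩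
  refine ⟨_, (hs.prodMk_nhds (hc.tendsto_apply hz)).isCompact_insert_range, ?_,
    fun k => mem_insert_of_mem _ (mem_range_self k)⟩
  rintro p (rfl | ⟨k, rfl⟩)
  · exact hne
  · exact fun h => hz ((g k).injective h).symm

theorem IsConicalLimitPt.exists_isConvSeq {G : Subgroup (M ≃ₜ M)} (hG : IsDiscreteConvGroup G)
    {x : M} (hx : IsConicalLimitPt G x) :
    ∃ g : ℕ → M ≃ₜ M, (∀ k, g k ∈ G) ∧ Function.Injective g ∧ ∃ α β : M, IsConvSeq g β x ∧
      Tendsto (fun k => g k x) atTop (𝓝 α) ∧ α ≠ β := by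
  obtain ⟨g, hg, hinj, hK⟩ := hx
  have := infinite_of_injective_homeo hinj
  obtain ⟨φ, hφ, zp, -, zm, -, hc⟩ := hG.exists_subseq hg hinj
  have hlim : ∀ z, z ≠ x → z ≠ zm → ∀ (ψ : ℕ → ℕ) (α : M), StrictMono ψ →
      Tendsto (fun k => g (φ (ψ k)) x) atTop (𝓝 α) → α ≠ zp := by
    intro z hzx hzm ψ α hψ hα
    obtain ⟨K, hKc, hKd, hKm⟩ := hK z hzx
    exact hKd _ (hKc.isClosed.mem_of_tendsto
      (hα.prodMk_nhds ((hc.comp hψ.tendsto_atTop).tendsto_apply hzm))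
      (Eventually.of_forall fun k => hKm _))
  obtain ⟨z, hz⟩ := (toFinite ({x, zm} : Set M)).exists_notMem
  simp only [mem_insert_iff, mem_singleton_iff, not_or] at hz
  have hxm : x = zm := by
    by_contra hne
    exact hlim z hz.1 hz.2 id zp strictMono_id (hc.tendsto_apply hne) rfl
  subst hxm
  obtain ⟨α, ψ, hψ, hα⟩ := CompactSpace.tendsto_subseq fun k => g (φ k) x
  exact ⟨fun k => g (φ (ψ k)), fun k => hg _, hinj.comp (hφ.injective.comp hψ.injective), α, zp,
    hc.comp hψ.tendsto_atTop, hα, hlim z hz.1 hz.2 ψ α hψ hα⟩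

theorem IsConvSeq.apply_attracting_eq {g : ℕ → M ≃ₜ M} {zp zm : M} (hc : IsConvSeq g zp zm)
    (hinj : Function.Injective g) {f : M ≃ₜ M} (hf : ∀ k x, f (g k x) = g k (f x)) :
    f zp = zp := by
  have := infinite_of_injective_homeo hinj
  obtain ⟨y, hy⟩ := (toFinite ({zm, f⁻¹ zm} : Set M)).exists_notMem
  simp only [mem_insert_iff, mem_singleton_iff, not_or] at hy
  have hfy : f y ≠ zm := fun h => hy.2 (by rw [← h, homeo_inv_apply_self])
  refine tendsto_nhds_unique ((f.continuous.tendsto _).comp (hc.tendsto_apply hy.1)) ?_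
  simpa only [Function.comp_def, hf] using hc.tendsto_apply hfy

/-- The powers of an element of infinite order with a single fixed point accumulate on it from
both sides. -/
theorem IsDiscreteConvGroup.exists_isConvSeq_pow {G : Subgroup (M ≃ₜ M)}
    (hG : IsDiscreteConvGroup G) {f : M ≃ₜ M} (hf : f ∈ G)
    (hinj : Function.Injective fun n : ℕ => f ^ n) {v : M} (hv : ∀ y, f y = y → y = v) :
    ∃ ψ : ℕ → ℕ, StrictMono ψ ∧ IsConvSeq (fun k => f ^ ψ k) v v := by
  obtain ⟨ψ, hψ, a, -, b, -, hc⟩ := hG.exists_subseq (fun n : ℕ => G.pow_mem hf n) hinj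
  have hinj' := hinj.comp hψ.injective
  have ha : a = v := by
    refine hv a (hc.apply_attracting_eq hinj' fun k x => ?_)
    show (f * f ^ ψ k) x = (f ^ ψ k * f) x
    rw [← pow_succ, ← pow_succ']
  have hb : b = v := by
    refine hv b (hc.inv.apply_attracting_eq (inv_injective.comp hinj') fun k x => ?_)
    show (f * (f ^ ψ k)⁻¹) x = ((f ^ ψ k)⁻¹ * f) x
    rw [((Commute.refl f).pow_right (ψ k)).inv_right.eq]
  subst ha
  subst hb
  exact ⟨ψ, hψ, hc⟩

/-- An element of infinite order with a single fixed point is not contracting from the complement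
of one open set into another one with disjoint closure. -/
theorem IsDiscreteConvGroup.not_mapsTo_of_unique_fixedPoint {G : Subgroup (M ≃ₜ M)}
    (hG : IsDiscreteConvGroup G) {f : M ≃ₜ M} (hf : f ∈ G)
    (hinj : Function.Injective fun n : ℕ => f ^ n) {v : M} (hv : ∀ y, f y = y → y = v)
    {N N' : Set M} (hN : N.Nonempty) (hN' : N'.Nonempty)
    (hdisj : Disjoint (closure N) (closure N')) : ¬ MapsTo f N'ᶜ N := by
  intro hmap
  obtain ⟨ψ, hψ, hc⟩ := hG.exists_isConvSeq_pow hf hinj hv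
  have hd : ∀ y ∈ N, y ∉ N' := fun y hy hy' =>
    Set.disjoint_left.1 hdisj (subset_closure hy) (subset_closure hy')
  have hmap' : MapsTo (f⁻¹ : M ≃ₜ M) Nᶜ N' := by
    intro y hy
    by_contra h
    have := hmap h
    rw [homeo_apply_inv_self] at this
    exact hy this
  have hpow : ∀ n : ℕ, MapsTo (f ^ n : M ≃ₜ M) N N := by
    intro n
    induction n with
    | zero => exact fun y hy => hy
    | succ n ih =>
      intro y hy
      rw [pow_succ']
      exact hmap (hd _ (ih hy))
  have hpow' : ∀ n : ℕ, MapsTo ((f ^ n)⁻¹ : M ≃ₜ M) N' N' := by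
    intro n
    induction n with
    | zero => exact fun y hy => hy
    | succ n ih =>
      intro y hy
      rw [pow_succ, mul_inv_rev]
      exact hmap' (fun h => hd _ h (ih hy))
  obtain ⟨y, hy⟩ := hN
  obtain ⟨y', hy'⟩ := hN'
  have h1 : v ∈ closure N := by
    by_cases hyv : y = v
    · exact hyv ▸ subset_closure hy
    · exact mem_closure_of_tendsto (hc.tendsto_apply hyv)
        (Eventually.of_forall fun k => hpow _ hy)
  have h2 : v ∈ closure N' := by
    by_cases hyv : y' = v
    · exact hyv ▸ subset_closure hy'
    · exact mem_closure_of_tendsto (hc.inv.tendsto_apply hyv)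
        (Eventually.of_forall fun k => hpow' _ hy')
  exact Set.disjoint_left.1 hdisj h1 h2

/-- A conical limit point is not fixed by a parabolic element. -/
theorem IsConicalLimitPt.not_isParabolicPt {G : Subgroup (M ≃ₜ M)} (hG : IsDiscreteConvGroup G)
    {c : M} (hc : IsConicalLimitPt G c) : ¬ IsParabolicPt G c := by
  rintro ⟨p, hp, hpar, hpc⟩
  have huniq : ∀ y, p y = y → y = c := fun y hy => hpar.2.unique hy hpc
  obtain ⟨g, hg, hinj, α, β, hcv, hα, hαβ⟩ := hc.exists_isConvSeq hG
  have := infinite_of_injective_homeo hinj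
  obtain ⟨z, hz⟩ := (toFinite ({c} : Set M)).exists_notMem
  have hz : z ≠ c := hz
  have hpz : p z ≠ c := fun h => hz (p.injective (h.trans hpc.symm))
  let f : ℕ → M ≃ₜ M := fun k => g k * p * (g k)⁻¹
  have hfG : ∀ k, f k ∈ G := fun k => G.mul_mem (G.mul_mem (hg k) hp) (G.inv_mem (hg k))
  have hfapply : ∀ k y, f k (g k y) = g k (p y) := fun k y => by
    simp only [f, homeo_mul_apply, homeo_inv_apply_self]
  have hffix : ∀ k y, f k y = y → y = g k c := by
    intro k y hy
    have h1 : p ((g k)⁻¹ y) = (g k)⁻¹ y := by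
      rw [← (g k).injective.eq_iff, ← hfapply, homeo_apply_inv_self, hy]
    rw [← huniq _ h1, homeo_apply_inv_self]
  have hfpow : ∀ k, Function.Injective fun n : ℕ => f k ^ n := by
    intro k m n hmn
    simp only [f, conj_pow] at hmn
    exact hpar.injective_pow (mul_left_cancel (mul_right_cancel hmn))
  have hu : Tendsto (fun k => g k z) atTop (𝓝 β) := hcv.tendsto_apply hz
  have hfu : Tendsto (fun k => f k (g k z)) atTop (𝓝 β) := by
    simp only [hfapply]
    exact hcv.tendsto_apply hpz
  have hfv : Tendsto (fun k => f k (g k c)) atTop (𝓝 α) := by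
    simp only [hfapply, hpc]
    exact hα
  obtain ⟨φ, hφ, ⟨F, hF⟩ | hφinj⟩ := exists_subseq_const_or_injective f
  · have h1 : F α = α := by
      refine tendsto_nhds_unique ((F.continuous.tendsto _).comp (hα.comp hφ.tendsto_atTop)) ?_
      have := hfv.comp hφ.tendsto_atTop
      simpa only [Function.comp_def, hF] using this
    have h2 : F β = β := by
      refine tendsto_nhds_unique ((F.continuous.tendsto _).comp (hu.comp hφ.tendsto_atTop)) ?_
      have := hfu.comp hφ.tendsto_atTop
      simpa only [Function.comp_def, hF] using this
    rw [← hF 0] at h1 h2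
    exact hαβ ((hffix _ _ h1).trans (hffix _ _ h2).symm)
  · obtain ⟨ψ, hψ, b, -, r, -, hc2⟩ := hG.exists_subseq (fun k => hfG (φ k)) hφinj
    have ht := hφ.tendsto_atTop.comp hψ.tendsto_atTop
    have h1 : α ≠ r → α = b := fun h =>
      tendsto_nhds_unique (hfv.comp ht) (hc2.tendsto (hα.comp ht) h)
    have h2 : β ≠ r → β = b := fun h =>
      tendsto_nhds_unique (hfu.comp ht) (hc2.tendsto (hu.comp ht) h)
    have hbr : b ≠ r := by
      rintro rfl
      by_cases h : α = b
      · exact hαβ (h.trans (by_contra fun h' => hαβ (h.trans (h2 (Ne.symm h')).symm)))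
      · exact h (h1 h)
    obtain ⟨N, hbN, hNo, N', hrN, hNo', hd⟩ := exists_open_nhds_disjoint_closure hbr
    obtain ⟨k, hk⟩ := (hc2 N'ᶜ hNo'.isClosed_compl.isCompact (fun h => h hrN) N
      (hNo.mem_nhds hbN)).exists
    exact hG.not_mapsTo_of_unique_fixedPoint (hfG _) (hfpow _) (hffix _) ⟨b, hbN⟩ ⟨r, hrN⟩ hd hk

end Conical

section HalfPingPong

variable {M : Type*} [TopologicalSpace M]

/-- One half of an amalgamated ping-pong configuration: the elements of `G ∖ J` take `B` into the
interior of `B'`. -/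
structure HalfPingPong (G J : Subgroup (M ≃ₜ M)) (B B' : Set M) : Prop where
  isClosed : IsClosed B
  int_nonempty : (interior B).Nonempty
  int_disjoint : Disjoint (interior B) (interior B')
  inv : ∀ j ∈ J, ⇑j '' B = B
  pp : ∀ g ∈ G, g ∉ J → ⇑g '' B ⊆ interior B'
  lim : limitSet G \ limitSet J ⊆ interior B'

namespace HalfPingPong

variable {G J : Subgroup (M ≃ₜ M)} {B B' : Set M}

theorem apply_mem_interior (h : HalfPingPong G J B B') {j : M ≃ₜ M} (hj : j ∈ J) {y : M}
    (hy : y ∈ interior B) : j y ∈ interior B := by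
  have := j.image_interior B
  rw [h.inv j hj] at this
  rw [← this]
  exact mem_image_of_mem j hy

theorem closure_interior_subset (h : HalfPingPong G J B B') : closure (interior B) ⊆ B :=
  closure_minimal interior_subset h.isClosed

end HalfPingPong

variable [CompactSpace M] [TopologicalSpace.MetrizableSpace M]

/-- A sequence of `G` in distinct `J`-cosets that takes `x` to a bounded parabolic point `c` of `G`
whose stabilizer lies in `J` cannot be normalized at `c`. -/
theorem not_normalized_of_isBoundedParabolicPt {G J : Subgroup (M ≃ₜ M)}
    (hG : IsDiscreteConvGroup G) (hJG : J ≤ G) {c x : M} (hcJ : c ∈ limitSet J)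
    (hJc : ¬ IsConicalLimitPt J c) (hGc : ¬ IsConicalLimitPt G c)
    (hbp : IsBoundedParabolicPt G c) (hstab : ∀ a ∈ G, a c = c → a ∈ J)
    (hΛ : ∀ s, ∃ y ∈ limitSet G, y ≠ s) (hx : x ∉ limitSet G) {f : ℕ → M ≃ₜ M}
    (hf : ∀ k, f k ∈ G) (hcoset : ∀ k l, k ≠ l → f k * (f l)⁻¹ ∉ J)
    (hfx : Tendsto (fun k => f k x) atTop (𝓝 c)) :
    ¬ ∀ a, a ≠ c → ∃ U ∈ 𝓝 a, ∃ V ∈ 𝓝 c, ∀ k, ∀ g ∈ J, g x ∈ V → g (f k x) ∉ U := by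
  intro hnorm
  have hxc : x ≠ c := fun h => hx (h ▸ limitSet_mono hJG hcJ)
  obtain ⟨-, K, hK, hKΛ, hKstab⟩ := hbp
  obtain ⟨s, φ, hφ, hs⟩ := CompactSpace.tendsto_subseq fun k => (f k)⁻¹ c
  obtain ⟨y, hyΛ, hys⟩ := hΛ s
  obtain ⟨N, hN⟩ := eventually_atTop.1 (hs.eventually_ne hys.symm)
  have hfy : ∀ k, f (φ (k + N)) y ≠ c := fun k h => hN (k + N) (by omega) (by
    show (f (φ (k + N)))⁻¹ c = y
    rw [← h, homeo_inv_apply_self])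
  choose h hhG hhc hhK using fun k => hKstab (f (φ (k + N)) y)
    ⟨smul_mem_limitSet (hf _) hyΛ, hfy k⟩
  have hhJ : ∀ k, h k ∈ J := fun k => hstab _ (hhG k) (hhc k)
  have hσ : StrictMono fun k => φ (k + N) := fun a b hab => hφ (by omega)
  have hAinj : Function.Injective fun k => h k * f (φ (k + N)) := by
    intro k l hkl
    by_contra hne
    refine hcoset _ _ (hσ.injective.ne hne) ?_
    have h1 : f (φ (k + N)) * (f (φ (l + N)))⁻¹ = (h k)⁻¹ * h l := by
      have h2 : h k * f (φ (k + N)) = h l * f (φ (l + N)) := hkl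
      rw [mul_inv_eq_iff_eq_mul, mul_assoc, ← h2, inv_mul_cancel_left]
    rw [h1]
    exact J.mul_mem (J.inv_mem (hhJ k)) (hhJ l)
  have hAG : ∀ k, h k * f (φ (k + N)) ∈ G := fun k => G.mul_mem (hhG k) (hf _)
  obtain ⟨ψ, hψ, κ, -, r, hr, hA⟩ := hG.exists_subseq hAG hAinj
  have hκ : Tendsto (fun k => h (ψ k) (f (φ (ψ k + N)) x)) atTop (𝓝 κ) :=
    hA.tendsto_apply fun h => hx (h ▸ hr)
  have hκc : κ ≠ c := by
    rintro rfl
    have hry : r = y := by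
      by_contra hne
      exact (hKΛ (hK.isClosed.mem_of_tendsto (hA.tendsto_apply (Ne.symm hne))
        (Eventually.of_forall fun k => hhK (ψ k)))).2 rfl
    subst hry
    refine hGc (hA.inv.isConicalLimitPt (s := s) (fun k => G.inv_mem (hAG _))
      (inv_injective.comp (hAinj.comp hψ.injective)) ?_ hys.symm)
    have h1 : ∀ k, ((h (ψ k) * f (φ (ψ k + N)))⁻¹ : M ≃ₜ M) κ = (f (φ (ψ k + N)))⁻¹ κ := by
      intro k
      have h2 : (h (ψ k))⁻¹ κ = κ := by
        conv_lhs => rw [← hhc (ψ k)]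
        rw [homeo_inv_apply_self]
      rw [mul_inv_rev, homeo_mul_apply, h2]
    simp only [Function.comp_apply, h1]
    exact hs.comp ((tendsto_add_atTop_nat N).comp hψ.tendsto_atTop)
  have hfx' : Tendsto (fun k => f (φ (ψ k + N)) x) atTop (𝓝 c) :=
    hfx.comp (hσ.tendsto_atTop.comp hψ.tendsto_atTop)
  obtain ⟨χ, hχ, ⟨h₀, hconst⟩ | hinj⟩ := exists_subseq_const_or_injective fun k => h (ψ k)
  · refine hκc (tendsto_nhds_unique (hκ.comp hχ.tendsto_atTop) ?_)
    have h1 : Tendsto (fun k => h₀ (f (φ (ψ (χ k) + N)) x)) atTop (𝓝 (h₀ c)) :=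
      (h₀.continuous.tendsto c).comp (hfx'.comp hχ.tendsto_atTop)
    have h2 : h₀ c = c := by rw [← hconst 0, hhc]
    rw [h2] at h1
    simpa only [Function.comp_def, hconst] using h1
  · obtain ⟨ω, hω, β, -, r', hr', hcv⟩ :=
      (hG.mono hJG).exists_subseq (fun k => hhJ (ψ (χ k))) hinj
    have hfix : Tendsto (fun k => h (ψ (χ (ω k))) c) atTop (𝓝 c) := by
      simp only [hhc]
      exact tendsto_const_nhds
    have hκ' := hκ.comp (hχ.tendsto_atTop.comp hω.tendsto_atTop)
    have hrc : r' = c := by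
      by_contra hne
      have h1 : c = β := tendsto_nhds_unique hfix (hcv.tendsto_apply (Ne.symm hne))
      have h2 : κ = β := tendsto_nhds_unique hκ'
        (hcv.tendsto (hfx'.comp (hχ.tendsto_atTop.comp hω.tendsto_atTop)) (Ne.symm hne))
      exact hκc (h2.trans h1.symm)
    subst hrc
    have hβc : r' = β := by
      by_contra hne
      exact hJc (hcv.isConicalLimitPt (fun k => hhJ _) (hinj.comp hω.injective) hfix hne)
    subst hβc
    obtain ⟨U, hU, V, hV, hUV⟩ := hnorm κ hκc
    obtain ⟨k, hk1, hk2⟩ :=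
      (((hcv.tendsto_apply hxc).eventually_mem hV).and (hκ'.eventually_mem hU)).exists
    exact hUV _ _ (hhJ _) hk1 hk2

namespace HalfPingPong

variable {G J : Subgroup (M ≃ₜ M)} {B B' : Set M}

theorem limitSet_subset (h : HalfPingPong G J B B') : limitSet J ⊆ closure (interior B) := by
  rintro c ⟨g, hg, hinj, zm, hc⟩
  obtain ⟨y, hy, hne⟩ := hc.exists_ne_mem hinj isOpen_interior h.int_nonempty
  exact mem_closure_of_tendsto (hc.tendsto_apply hne)
    (Eventually.of_forall fun k => h.apply_mem_interior (hg k) hy)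

theorem mem_of_apply_eq (h : HalfPingPong G J B B') {c : M} (hc : c ∈ limitSet J)
    {a : M ≃ₜ M} (ha : a ∈ G) (hac : a c = c) : a ∈ J := by
  by_contra haJ
  have h1 := h.limitSet_subset hc
  have h2 : c ∈ interior B' :=
    h.pp a ha haJ ⟨c, h.closure_interior_subset h1, hac⟩
  obtain ⟨y, hy, hyB⟩ := mem_closure_iff.1 h1 _ isOpen_interior h2
  exact Set.disjoint_left.1 h.int_disjoint hyB hy

/-- A limit, outside the limit set, of translates of points of the interior of `B` by elements of
`G ∖ J` lies in a single translate of `B`. -/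
theorem exists_mem_image_of_tendsto (h : HalfPingPong G J B B') (hG : IsDiscreteConvGroup G)
    (hJG : J ≤ G) (hgf : IsGeomFinite G) (hJgf : IsGeomFinite J) {x : M} (hx : x ∉ limitSet G)
    {a : ℕ → M ≃ₜ M} (ha : ∀ k, a k ∈ G ∧ a k ∉ J) {u : ℕ → M} (hu : ∀ k, u k ∈ interior B)
    (hau : Tendsto (fun k => a k (u k)) atTop (𝓝 x)) : ∃ g, (g ∈ G ∧ g ∉ J) ∧ x ∈ ⇑g '' B := by
  let R : (M ≃ₜ M) → (M ≃ₜ M) → Prop := fun a b => a⁻¹ * b ∈ J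
  have : IsTrans (M ≃ₜ M) R := ⟨fun a b c hab hbc => by
    have := J.mul_mem hab hbc
    rwa [mul_assoc, mul_inv_cancel_left] at this⟩
  obtain ⟨φ, hφ, hcase⟩ := exists_subseq_rel_or_not_rel R (fun a b hab => by
    have := J.inv_mem hab
    rwa [mul_inv_rev, inv_inv] at this) a
  have hau' := hau.comp hφ.tendsto_atTop
  rcases hcase with hsame | hdiff
  · refine ⟨a (φ 0), ha _, (a (φ 0))⁻¹ x, h.closure_interior_subset ?_, homeo_apply_inv_self _ _⟩
    refine mem_closure_of_tendsto ((((a (φ 0))⁻¹).continuous.tendsto x).comp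
      (hau'.comp (tendsto_add_atTop_nat 1))) (Eventually.of_forall fun n => ?_)
    exact h.apply_mem_interior (hsame n) (hu _)
  · exfalso
    have hJd := hG.mono hJG
    have hxJ : x ∉ limitSet J := fun h' => hx (limitSet_mono hJG h')
    obtain ⟨j, hj, hnorm⟩ := hJd.exists_normalization hxJ (w := fun k => (a (φ k))⁻¹ x)
      (fun k hk => hx ((smul_mem_limitSet_iff (G.inv_mem (ha _).1)).1 (limitSet_mono hJG hk)))
    have hfG : ∀ k, j k * (a (φ k))⁻¹ ∈ G := fun k =>
      G.mul_mem (hJG (hj k)) (G.inv_mem (ha _).1)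
    have hcoset : ∀ k l, k ≠ l → j k * (a (φ k))⁻¹ * (j l * (a (φ l))⁻¹)⁻¹ ∉ J := by
      intro k l hkl hmem
      refine hdiff k l hkl ?_
      have h1 := J.mul_mem (J.mul_mem (J.inv_mem (hj k)) hmem) (hj l)
      have h2 : (j k)⁻¹ * (j k * (a (φ k))⁻¹ * (j l * (a (φ l))⁻¹)⁻¹) * j l =
          (a (φ k))⁻¹ * a (φ l) := by group
      rwa [h2] at h1
    have hfinj : Function.Injective fun k => j k * (a (φ k))⁻¹ := by
      intro k l hkl
      by_contra hne
      refine hcoset k l hne ?_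
      have hkl : j k * (a (φ k))⁻¹ = j l * (a (φ l))⁻¹ := hkl
      rw [hkl, mul_inv_cancel]
      exact J.one_mem
    obtain ⟨ψ, hψ, c, hcG, r, hr, hcv⟩ := hG.exists_subseq hfG hfinj
    have hxr : x ≠ r := fun h' => hx (h' ▸ hr)
    have hfx := hcv.tendsto_apply hxr
    by_cases hcJ : c ∈ limitSet J
    · have hxc : x ≠ c := fun h' => hx (h' ▸ hcG)
      by_cases hcon : IsConicalLimitPt J c
      · obtain ⟨g, hg, hginj, α, β, hgc, hgα, hαβ⟩ := hcon.exists_isConvSeq hJd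
        obtain ⟨U, hU, V, hV, hUV⟩ := hnorm α β (hgc.mem_limitSet hg hginj) hαβ
        obtain ⟨m, hm1, hm2⟩ := (((hgc.tendsto_apply hxc).eventually_mem hV).and
          (hgα.eventually_mem (interior_mem_nhds.2 hU))).exists
        obtain ⟨k, hk⟩ := ((((g m).continuous.tendsto c).comp hfx).eventually_mem
          (mem_interior_iff_mem_nhds.1 hm2)).exists
        exact hUV _ _ (hg m) hm1 hk
      · obtain ⟨⟨q, hq, hqpar, hqc⟩, -⟩ := (hJgf c hcJ).resolve_left hcon
        have hGc : ¬ IsConicalLimitPt G c := fun h' =>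
          h'.not_isParabolicPt hG ⟨q, hJG hq, hqpar, hqc⟩
        refine not_normalized_of_isBoundedParabolicPt hG hJG hcJ hcon hGc
          ((hgf c hcG).resolve_left hGc) (fun a ha hac => h.mem_of_apply_eq hcJ ha hac)
          (fun s => ?_) hx (fun k => hfG (ψ k)) (fun k l hkl => hcoset _ _ (hψ.injective.ne hkl))
          hfx fun b hbc => ?_
        · by_contra! hs
          refine (ha 0).2 (h.mem_of_apply_eq hcJ (ha 0).1 ?_)
          rw [hs _ (smul_mem_limitSet (ha 0).1 hcG), hs c hcG]
        · obtain ⟨U, hU, V, hV, hUV⟩ := hnorm b c hcJ hbc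
          exact ⟨U, hU, V, hV, fun k g hg => hUV (ψ k) g hg⟩
    · have hlim := hcv.tendsto (hau'.comp hψ.tendsto_atTop) hxr
      obtain ⟨k, hk⟩ := (hlim.eventually_mem
        (isOpen_interior.mem_nhds (h.lim ⟨hcG, hcJ⟩))).exists
      refine Set.disjoint_left.1 h.int_disjoint (h.apply_mem_interior (hj (ψ k)) (hu (φ (ψ k)))) ?_
      simpa only [Function.comp_apply, homeo_mul_apply, homeo_inv_apply_self] using hk

end HalfPingPong

end HalfPingPong

section Amalgam

/-- Alternating products of elements of `G false ∖ J` and `G true ∖ J`, with first factor in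
`G i`. -/
inductive IsAltProd {Γ : Type*} [Group Γ] (G : Bool → Subgroup Γ) (J : Subgroup Γ) :
    Bool → Γ → Prop
  | single {i : Bool} {a : Γ} : a ∈ G i → a ∉ J → IsAltProd G J i a
  | cons {i : Bool} {a h : Γ} : a ∈ G i → a ∉ J → IsAltProd G J (!i) h → IsAltProd G J i (a * h)

section Group

variable {Γ : Type*} [Group Γ] {G : Bool → Subgroup Γ} {J : Subgroup Γ}

theorem IsAltProd.mul_left_of_mem (hJ : ∀ i, J ≤ G i) {i : Bool} {c h : Γ} (hc : c ∈ J)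
    (hh : IsAltProd G J i h) : IsAltProd G J i (c * h) := by
  have hmul : ∀ a, a ∉ J → c * a ∉ J := fun a ha h' => ha ((J.mul_mem_cancel_left hc).1 h')
  cases hh with
  | single ha haJ => exact .single ((G i).mul_mem (hJ i hc) ha) (hmul _ haJ)
  | cons ha haJ hh =>
    rw [← mul_assoc]
    exact .cons ((G i).mul_mem (hJ i hc) ha) (hmul _ haJ) hh

theorem IsAltProd.mul_left (hJ : ∀ i, J ≤ G i) {i i' : Bool} {c h : Γ} (hc : c ∈ G i)
    (hcJ : c ∉ J) (hh : IsAltProd G J i' h) :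
    c * h ∈ J ∨ ∃ i', IsAltProd G J i' (c * h) := by
  by_cases hi : i' = i
  · subst hi
    cases hh with
    | single ha haJ =>
      by_cases hca : c * h ∈ J
      · exact Or.inl hca
      · exact Or.inr ⟨i', .single ((G i').mul_mem hc ha) hca⟩
    | @cons _ a h ha haJ hh =>
      rw [← mul_assoc]
      by_cases hca : c * a ∈ J
      · exact Or.inr ⟨!i', hh.mul_left_of_mem hJ hca⟩
      · exact Or.inr ⟨i', .cons ((G i').mul_mem hc ha) hca hh⟩
  · refine Or.inr ⟨i, .cons hc hcJ ?_⟩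
    rwa [show (!i) = i' by cases i <;> cases i' <;> simp_all]

theorem mem_or_exists_isAltProd (hJ : ∀ i, J ≤ G i) {g : Γ} (hg : g ∈ G false ⊔ G true) :
    g ∈ J ∨ ∃ i, IsAltProd G J i g := by
  have hmul : ∀ i, ∀ c ∈ G i, ∀ g, (g ∈ J ∨ ∃ i, IsAltProd G J i g) →
      (c * g ∈ J ∨ ∃ i, IsAltProd G J i (c * g)) := by
    rintro i c hc g (hg | ⟨i', hg⟩) <;> by_cases hcJ : c ∈ J
    · exact Or.inl (J.mul_mem hcJ hg)
    · exact Or.inr ⟨i, .single ((G i).mul_mem hc (hJ i hg))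
        fun h => hcJ ((J.mul_mem_cancel_right hg).1 h)⟩
    · exact Or.inr ⟨i', hg.mul_left_of_mem hJ hcJ⟩
    · exact hg.mul_left hJ hc hcJ
  rw [Subgroup.sup_eq_closure] at hg
  induction hg using Subgroup.closure_induction_left with
  | one => exact Or.inl J.one_mem
  | mul_left c hc g _ ih => exact hc.elim (fun h => hmul _ c h g ih) fun h => hmul _ c h g ih
  | inv_mul_cancel c hc g _ ih =>
    exact hc.elim (fun h => hmul _ _ (inv_mem h) g ih) fun h => hmul _ _ (inv_mem h) g ih

end Group

variable {M : Type*} [TopologicalSpace M] {G : Bool → Subgroup (M ≃ₜ M)} {J : Subgroup (M ≃ₜ M)}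
  {B : Bool → Set M}

theorem HalfPingPong.mapsTo_interior {G J : Subgroup (M ≃ₜ M)} {B B' : Set M}
    (h : HalfPingPong G J B B') {a : M ≃ₜ M} (ha : a ∈ G) (haJ : a ∉ J) :
    MapsTo a (interior B) (interior B') :=
  fun _ hy => h.pp a ha haJ (mem_image_of_mem a (interior_subset hy))

theorem IsAltProd.exists_mapsTo (hB : ∀ i, HalfPingPong (G i) J (B i) (B !i)) {i : Bool}
    {h : M ≃ₜ M} (hh : IsAltProd G J i h) :
    ∃ t, MapsTo h (interior (B t)) (interior (B !i)) := by
  induction hh with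
  | @single i a ha haJ => exact ⟨i, (hB i).mapsTo_interior ha haJ⟩
  | @cons i a h ha haJ _ ih =>
    obtain ⟨t, ht⟩ := ih
    rw [Bool.not_not] at ht
    exact ⟨t, ((hB i).mapsTo_interior ha haJ).comp ht⟩

theorem exists_mem_or_exists_mapsTo_image (hJ : ∀ i, J ≤ G i)
    (hB : ∀ i, HalfPingPong (G i) J (B i) (B !i)) {g : M ≃ₜ M} (hg : g ∈ G false ⊔ G true) :
    (∃ i, g ∈ G i) ∨ ∃ i t a, (a ∈ G i ∧ a ∉ J) ∧
      MapsTo g (interior (B t)) (a '' interior (B i)) := by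
  obtain hg | ⟨i, hg⟩ := mem_or_exists_isAltProd hJ hg
  · exact Or.inl ⟨true, hJ _ hg⟩
  · cases hg with
    | single ha _ => exact Or.inl ⟨i, ha⟩
    | @cons _ a h ha haJ hh =>
      obtain ⟨t, ht⟩ := hh.exists_mapsTo hB
      rw [Bool.not_not] at ht
      exact Or.inr ⟨i, t, a, ⟨ha, haJ⟩, fun y hy => ⟨h y, ht hy, rfl⟩⟩

theorem exists_mem_image_of_mem_limitSet_sup [CompactSpace M]
    [TopologicalSpace.MetrizableSpace M] (hd : ∀ i, IsDiscreteConvGroup (G i))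
    (hJ : ∀ i, J ≤ G i) (hB : ∀ i, HalfPingPong (G i) J (B i) (B !i)) (hJgf : IsGeomFinite J)
    (hgf : ∀ i, IsGeomFinite (G i)) {x : M} (hx : x ∈ limitSet (G false ⊔ G true))
    (hxG : ∀ i, x ∉ limitSet (G i)) : ∃ i g, (g ∈ G i ∧ g ∉ J) ∧ x ∈ ⇑g '' B i := by
  obtain ⟨g, hg, hinj, zm, hc⟩ := hx
  choose y hy hyz using fun t => hc.exists_ne_mem hinj isOpen_interior (hB t).int_nonempty
  by_cases h1 : ∃ i, ∃ᶠ k in atTop, g k ∈ G i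
  · obtain ⟨i, hi⟩ := h1
    obtain ⟨φ, hφ, hφi⟩ := extraction_of_frequently_atTop hi
    exact absurd ((hc.comp hφ.tendsto_atTop).mem_limitSet hφi (hinj.comp hφ.injective)) (hxG i)
  by_cases h2 : ∃ i t, ∃ᶠ k in atTop, ∃ a, (a ∈ G i ∧ a ∉ J) ∧
      MapsTo (g k) (interior (B t)) (a '' interior (B i))
  · obtain ⟨i, t, hi⟩ := h2
    obtain ⟨φ, hφ, hφi⟩ := extraction_of_frequently_atTop hi
    choose a ha hmap using hφi
    choose u hu hau using fun k => hmap k (hy t)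
    refine ⟨i, (hB i).exists_mem_image_of_tendsto (hd i) (hJ i) (hgf i) hJgf (hxG i) ha hu ?_⟩
    simp only [hau]
    exact (hc.tendsto_apply (hyz t)).comp hφ.tendsto_atTop
  · exfalso
    simp only [not_exists, not_frequently, ← eventually_all] at h1 h2
    obtain ⟨k, hk1, hk2⟩ := (h1.and h2).exists
    rcases exists_mem_or_exists_mapsTo_image hJ hB (hg k) with ⟨i, hi⟩ | ⟨i, t, a, ha⟩
    · exact hk1 i hi
    · exact hk2 i t a ha

theorem AFPPingPong.halfPingPong {G₁ G₂ J : Subgroup (M ≃ₜ M)} {B₁ B₂ : Set M}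
    (h : AFPPingPong G₁ G₂ J B₁ B₂) :
    HalfPingPong G₁ J B₁ B₂ ∧ HalfPingPong G₂ J B₂ B₁ := by
  have hd : Disjoint (interior B₁) (interior B₂) := disjoint_iff_inter_eq_empty.2 h.int_disjoint
  exact ⟨⟨h.isClosed₁, h.int_nonempty₁, hd, h.inv₁, h.pp₁, h.lim₁⟩,
    ⟨h.isClosed₂, h.int_nonempty₂, hd.symm, h.inv₂, h.pp₂, h.lim₂⟩⟩

end Amalgam

/-- If `G₁` and `G₂` are geometrically finite, then
`Λ(G) ∖ (Λ(G₁) ∪ Λ(G₂)) ⊆ T₁`, where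
`T₁ = ⋃_{g ∈ G₁ ∖ J} g B₁ ∪ ⋃_{g ∈ G₂ ∖ J} g B₂`. -/
theorem statement_14 {M : Type*} [TopologicalSpace M] [CompactSpace M]
    [TopologicalSpace.MetrizableSpace M]
    (G₁ G₂ J G : Subgroup (M ≃ₜ M))
    (hd₁ : IsDiscreteConvGroup G₁) (hd₂ : IsDiscreteConvGroup G₂)
    (hJ : J = G₁ ⊓ G₂) (hJgf : IsGeomFinite J) (hJlt₁ : J < G₁) (hJlt₂ : J < G₂)
    (B₁ B₂ : Set M) (hpp : AFPPingPong G₁ G₂ J B₁ B₂)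
    (hG : G = G₁ ⊔ G₂) (hGconv : IsConvGroup G)
    (hgf₁ : IsGeomFinite G₁) (hgf₂ : IsGeomFinite G₂) :
    limitSet G \ (limitSet G₁ ∪ limitSet G₂) ⊆
      (⋃ g ∈ {g : M ≃ₜ M | g ∈ G₁ ∧ g ∉ J}, ⇑g '' B₁) ∪
        ⋃ g ∈ {g : M ≃ₜ M | g ∈ G₂ ∧ g ∉ J}, ⇑g '' B₂ := by
  rintro x ⟨hx, hxG⟩
  simp only [mem_union, not_or] at hxG
  obtain ⟨hB₁, hB₂⟩ := hpp.halfPingPong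
  subst hG
  obtain ⟨i, g, hg, hgx⟩ := exists_mem_image_of_mem_limitSet_sup
    (G := fun i => bif i then G₂ else G₁) (J := J) (B := fun i => bif i then B₂ else B₁)
    (Bool.forall_bool.2 ⟨hd₁, hd₂⟩) (Bool.forall_bool.2 ⟨hJlt₁.le, hJlt₂.le⟩)
    (Bool.forall_bool.2 ⟨hB₁, hB₂⟩) hJgf (Bool.forall_bool.2 ⟨hgf₁, hgf₂⟩) hx
    (Bool.forall_bool.2 hxG)
  cases i
  · exact Or.inl (mem_biUnion hg hgx)
  · exact Or.inr (mem_biUnion hg hgx)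

end ConvergenceGroups
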